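/- arXiv:0903.0052 — 3 statements merged into one kernel-verified Lean document; each statement's English description precedes it below -/
import Mathlib

section
/- Let A be a domain, p a prime of A, and R the symbolic Rees algebra of p. If A is a Jaffard domain (dim A = dim_v A < ∞), then R is a Jaffard domain with dim R = 1 + dim A. -/
noncomputable section

open LaurentPolynomial

/-- The `n`-th symbolic power `p^(n) := pⁿA_p ∩ A` of a prime ideal `p`. -/
def symbolicPower (A : Type*) [CommRing A] (p : Ideal A) [p.IsPrime] (n : ℕ) : Ideal A :=
  Ideal.comap (algebraMap A (Localization.AtPrime p))
    (Ideal.map (algebraMap A (Localization.AtPrime p)) (p ^ n))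

/-- The symbolic Rees algebra `R := A[t⁻¹, pt, p^(2)t², …] = ⊕_{n∈ℤ} p^(n)tⁿ`,
as a subalgebra of the Laurent polynomial ring `A[t, t⁻¹]`. -/
def symbolicReesAlgebra (A : Type*) [CommRing A] (p : Ideal A) [p.IsPrime] :
    Subalgebra A (LaurentPolynomial A) :=
  Algebra.adjoin A
    ({T (-1)} ∪ ⋃ n : ℕ, (fun x => C x * T (n : ℤ)) '' (symbolicPower A p n : Set A))

instance (A : Type*) [CommRing A] [IsDomain A] : IsDomain (LaurentPolynomial A) :=
  NoZeroDivisors.to_isDomain _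

/-- The valuative dimension of a domain `A`: the supremum of the Krull dimensions of the
valuation overrings of `A` (subrings of the fraction field of `A` containing `A` in which,
for every nonzero element `x` of the fraction field, `x` or `x⁻¹` lies). -/
def valuativeDim (A : Type*) [CommRing A] [IsDomain A] : WithBot ℕ∞ :=
  ⨆ (V : Subring (FractionRing A))
    (_ : Set.range (algebraMap A (FractionRing A)) ⊆ (V : Set (FractionRing A)))
    (_ : ∀ x : FractionRing A, x ≠ 0 → x ∈ V ∨ x⁻¹ ∈ V), ringKrullDim ↥V

/-- A domain is Jaffard if it is finite-dimensional and its Krull dimension equals its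
valuative dimension. -/
def IsJaffard (A : Type*) [CommRing A] [IsDomain A] : Prop :=
  ringKrullDim A = valuativeDim A ∧ ringKrullDim A < ⊤

open IsLocalRing in
theorem ValuationSubring.exists_succ_le_ringKrullDim_of_residueField {K : Type*} [Field K]
    (V : ValuationSubring K) (W : ValuationSubring (ResidueField V)) {r : V} (hr : r ≠ 0)
    (hr' : residue V r = 0) :
    ∃ U : ValuationSubring K, (∀ x : V, residue V x ∈ W → (x : K) ∈ U) ∧
      ringKrullDim W + 1 ≤ ringKrullDim U := by
  let S : Subring V := W.toSubring.comap (residue V)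
  have hS : ∀ x : V, residue V x ∈ W ↔ x ∈ S := fun x ↦ Iff.rfl
  have key : ∀ x ∈ V, x ∈ S.map V.subtype ∨ x⁻¹ ∈ S.map V.subtype := by
    intro x hx
    rcases W.mem_or_inv_mem (residue V ⟨x, hx⟩) with h | h
    · exact .inl ⟨⟨x, hx⟩, h, rfl⟩
    · by_cases hu : IsUnit (⟨x, hx⟩ : V)
      · obtain ⟨u, hu⟩ := hu
        have hux : ((u⁻¹ : Vˣ) : V) = x⁻¹ := by
          have h1 : ((u : V) : K) * ((u⁻¹ : Vˣ) : V) = 1 := by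
            exact_mod_cast congrArg Subtype.val u.mul_inv
          rw [hu] at h1
          exact eq_inv_of_mul_eq_one_right h1
        refine .inr ⟨((u⁻¹ : Vˣ) : V), ?_, hux⟩
        change residue V _ ∈ W
        rw [← hu] at h
        rwa [map_units_inv]
      · refine .inl ⟨⟨x, hx⟩, ?_, rfl⟩
        change residue V _ ∈ W
        rw [(residue_eq_zero_iff _).2 hu]
        exact W.zero_mem
  let U : ValuationSubring K := ⟨S.map V.subtype, fun x ↦ by
    rcases V.mem_or_inv_mem x with hx | hx
    · exact key x hx
    · simpa [or_comm] using key _ hx⟩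
  refine ⟨U, fun x hx ↦ ⟨x, hx, rfl⟩, ?_⟩
  have e : S ≃+* U := S.equivMapOfInjective V.subtype V.subtype_injective
  rw [← ringKrullDim_eq_of_ringEquiv e]
  let g : S →+* W := ((residue V).comp S.subtype).codRestrict W fun x ↦ x.2
  have hrS : r ∈ S := by rw [← hS, hr']; exact W.zero_mem
  refine ringKrullDim_succ_le_of_surjective g ?_ (r := ⟨r, hrS⟩) ?_ ?_
  · rintro ⟨w, hw⟩
    obtain ⟨x, rfl⟩ := residue_surjective w
    exact ⟨⟨x, hw⟩, rfl⟩
  · exact mem_nonZeroDivisors_of_ne_zero fun h ↦ hr congr(($h : V))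
  · exact Subtype.ext hr'

open IsLocalRing in
theorem exists_valuationSubring_natCast_le_ringKrullDim {R : Type*} [CommRing R] (n : ℕ)
    {c : Fin (n + 1) → PrimeSpectrum R} (hc : StrictMono c) {K : Type*} [Field K] (f : R →+* K)
    (hf : RingHom.ker f ≤ (c 0).asIdeal) :
    ∃ V : ValuationSubring K, (∀ x, f x ∈ V) ∧ (n : WithBot ℕ∞) ≤ ringKrullDim V := by
  induction n generalizing K with
  | zero => exact ⟨⊤, fun _ ↦ trivial, by simp⟩
  | succ n ih =>
    set P := (c 1).asIdeal with hP
    have h01 : c 0 < c 1 := hc (by simp)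
    have hunit : ∀ y : P.primeCompl, IsUnit (f y) := fun y ↦
      isUnit_iff_ne_zero.2 fun h ↦ y.2 (h01.le (hf h))
    let F : Localization.AtPrime P →+* K := IsLocalization.lift hunit
    have hF : ∀ x, F (algebraMap R _ x) = f x := IsLocalization.lift_eq hunit
    obtain ⟨V, hV, hloc⟩ := exists_factor_valuationRing F
    let g := (F.codRestrict V.toSubring hV).comp (algebraMap R (Localization.AtPrime P))
    let f' : R →+* ResidueField V := (residue V).comp g
    have hf' (x : R) : f' x = 0 ↔ x ∈ P := by
      rw [← IsLocalization.AtPrime.to_map_mem_maximal_iff (Localization.AtPrime P) P x,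
        mem_maximalIdeal, mem_nonunits_iff, ← isUnit_map_iff (F.codRestrict V.toSubring hV)]
      exact residue_eq_zero_iff _
    obtain ⟨W, hW, hn⟩ := ih (c := c ∘ Fin.succ) (hc.comp Fin.strictMono_succ) f' fun x hx ↦
      (hf' x).1 hx
    obtain ⟨r, hr, hr'⟩ := SetLike.exists_of_lt (PrimeSpectrum.asIdeal_lt_asIdeal _ _ |>.2 h01)
    obtain ⟨U, hU, hd⟩ := V.exists_succ_le_ringKrullDim_of_residueField W (r := g r)
      (fun h ↦ hr' (hf ((hF r).symm.trans congr(($h : K))))) ((hf' r).2 hr)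
    refine ⟨U, fun x ↦ ?_, ?_⟩
    · rw [← hF]
      exact hU (g x) (hW x)
    · push_cast
      exact (add_le_add_left hn 1).trans hd

theorem Valuation.exists_ne_eq_of_sum_eq_zero {L Γ ι : Type*} [Field L]
    [LinearOrderedCommGroupWithZero Γ] (v : Valuation L Γ) {s : Finset ι} (hs : s.Nonempty)
    {t : ι → L} (ht : ∀ i ∈ s, t i ≠ 0) (h : ∑ i ∈ s, t i = 0) :
    ∃ i ∈ s, ∃ j ∈ s, i ≠ j ∧ v (t i) = v (t j) := by
  classical
  obtain ⟨i, hi, hmax⟩ := s.exists_max_image (fun i ↦ v (t i)) hs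
  by_contra! H
  have hlt : v (∑ j ∈ s.erase i, t j) < v (t i) :=
    v.map_sum_lt (by simpa using ht i hi) fun j hj ↦
      (hmax j (Finset.mem_of_mem_erase hj)).lt_of_ne
        (H j (Finset.mem_of_mem_erase hj) i hi (Finset.ne_of_mem_erase hj))
  rw [← Finset.add_sum_erase s t hi, add_eq_zero_iff_eq_neg] at h
  rw [h, v.map_neg] at hlt
  exact hlt.false

namespace ValuationSubring

variable {K L : Type*} [Field K] [Field L] [Algebra K L]

/-- The inclusion of the contraction of a valuation subring into it. -/
def comapInclusion (V : ValuationSubring L) : V.comap (algebraMap K L) →+* V :=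
  ((algebraMap K L).comp (V.comap (algebraMap K L)).subtype).codRestrict V fun x ↦ x.2

theorem valuation_ne_of_comap_le {V : ValuationSubring L} {P Q : Ideal V} [P.IsPrime] [Q.IsPrime]
    (h : Q.comap (V.comapInclusion (K := K)) ≤ P.comap (V.comapInclusion (K := K)))
    {y w w' : V} (hyQ : y ∈ Q) (hyP : y ∉ P) (hw : w ∉ Q) (hw' : w' ∉ P) {e : K} {k : ℕ}
    (hk : k ≠ 0) : V.valuation (algebraMap K L e * w) ≠ V.valuation (y ^ k * w' : L) := by
  intro H
  obtain ⟨u, hu⟩ := (V.valuation_eq_iff _ _).1 H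
  have hyk : y ^ k * w' ∈ Q := Q.mul_mem_right _ (Q.pow_mem_of_mem hyQ k (Nat.pos_of_ne_zero hk))
  have hyk' : y ^ k * w' ∉ P := fun hh ↦
    (Ideal.IsPrime.mem_or_mem ‹_› hh).elim (fun h ↦ hyP (Ideal.IsPrime.mem_of_pow_mem ‹_› _ h)) hw'
  by_cases he : algebraMap K L e ∈ V
  · have heq : V.comapInclusion ⟨e, he⟩ * w = u * (y ^ k * w') := Subtype.ext hu.symm
    have h1 : V.comapInclusion ⟨e, he⟩ ∈ Q :=
      (Ideal.IsPrime.mem_or_mem ‹Q.IsPrime› (heq ▸ Q.mul_mem_left _ hyk)).resolve_right hw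
    have h2 : V.comapInclusion ⟨e, he⟩ ∈ P := h (Ideal.mem_comap.2 h1)
    have h3 : (u : V) * (y ^ k * w') ∈ P := heq ▸ P.mul_mem_right _ h2
    exact hyk' ((Ideal.unit_mul_mem_iff_mem P u.isUnit).1 h3)
  · have he' : algebraMap K L e⁻¹ ∈ V := by
      rw [map_inv₀]; exact (V.mem_or_inv_mem _).resolve_left he
    have he0 : algebraMap K L e ≠ 0 := fun h ↦ he (h ▸ V.zero_mem)
    have heq : w = (u * ⟨_, he'⟩) * (y ^ k * w') := Subtype.ext <| by
      change (w : L) = ((u : V) : L) * algebraMap K L e⁻¹ * ((y : L) ^ k * w')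
      rw [mul_right_comm, hu, map_inv₀]
      field_simp
    exact hw (heq ▸ Q.mul_mem_left _ hyk)

theorem not_comap_le_and_comap_le (hL : Algebra.trdeg K L ≤ 1) {V : ValuationSubring L}
    {P₁ P₂ P₃ P₄ : Ideal V} [P₁.IsPrime] [P₂.IsPrime] [P₃.IsPrime] [P₄.IsPrime]
    (h₁₂ : P₁ < P₂) (h₂₃ : P₂ ≤ P₃) (h₃₄ : P₃ < P₄)
    (h : P₂.comap (V.comapInclusion (K := K)) ≤ P₁.comap (V.comapInclusion (K := K)))
    (h' : P₄.comap (V.comapInclusion (K := K)) ≤ P₃.comap (V.comapInclusion (K := K))) :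
    False := by
  obtain ⟨y, hy₂, hy₁⟩ := SetLike.exists_of_lt h₁₂
  obtain ⟨z, hz₄, hz₃⟩ := SetLike.exists_of_lt h₃₄
  have hz₂ : z ∉ P₂ := fun hz ↦ hz₃ (h₂₃ hz)
  have hz₁ : z ∉ P₁ := fun hz ↦ hz₂ (h₁₂.le hz)
  have hy0 : (y : L) ≠ 0 := fun h ↦ hy₁ ((Subtype.ext h : y = 0) ▸ P₁.zero_mem)
  have hz0 : (z : L) ≠ 0 := fun h ↦ hz₃ ((Subtype.ext h : z = 0) ▸ P₃.zero_mem)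
  have hdep : ¬ AlgebraicIndependent K ![(y : L), (z : L)] := fun hind ↦ by
    have h2 := hind.lift_cardinalMk_le_trdeg
    have h3 := h2.trans (Cardinal.lift_le.2 hL)
    simp at h3
  rw [algebraicIndependent_iff] at hdep
  push Not at hdep
  obtain ⟨p, hp, hp0⟩ := hdep
  have key : ∀ a b a' b' : ℕ, ∀ c c' : K, c ≠ 0 → c' ≠ 0 → a < a' ∨ a = a' ∧ b < b' →
      V.valuation (algebraMap K L c * (y ^ a * z ^ b)) ≠
        V.valuation (algebraMap K L c' * (y ^ a' * z ^ b')) := by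
    intro a b a' b' c c' hc hc' hlt H
    have hc0 : algebraMap K L c ≠ 0 := by simpa
    have hc0' : algebraMap K L c' ≠ 0 := by simpa
    rcases hlt with hlt | ⟨rfl, hlt⟩
    · obtain ⟨k, rfl⟩ := Nat.exists_eq_add_of_lt hlt
      refine valuation_ne_of_comap_le h hy₂ hy₁ (w := z ^ b) (w' := z ^ b')
        (fun hh ↦ hz₂ (Ideal.IsPrime.mem_of_pow_mem ‹_› _ hh))
        (fun hh ↦ hz₁ (Ideal.IsPrime.mem_of_pow_mem ‹_› _ hh)) (e := c / c')
        (k := k + 1) (by simp) ?_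
      have e1 : algebraMap K L (c / c') * ((z ^ b : V) : L) =
        algebraMap K L c * (y ^ a * z ^ b) * (algebraMap K L c' * y ^ a)⁻¹ := by
        push_cast [map_div₀]; field_simp
      have e2 : (y ^ (k + 1) * ((z ^ b' : V) : L) : L) =
        algebraMap K L c' * (y ^ (a + k + 1) * z ^ b') * (algebraMap K L c' * y ^ a)⁻¹ := by
        push_cast; field_simp; ring
      rw [e1, e2, map_mul, H, ← map_mul]
    · obtain ⟨k, rfl⟩ := Nat.exists_eq_add_of_lt hlt
      refine valuation_ne_of_comap_le h' hz₄ hz₃ (w := 1) (w' := 1)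
        P₄.one_notMem P₃.one_notMem (e := c / c') (k := k + 1) (by simp) ?_
      have e1 : algebraMap K L (c / c') * ((1 : V) : L) =
        algebraMap K L c * (y ^ a * z ^ b) * (algebraMap K L c' * (y ^ a * z ^ b))⁻¹ := by
        push_cast [map_div₀]; field_simp
      have e2 : (z ^ (k + 1) * ((1 : V) : L) : L) =
        algebraMap K L c' * (y ^ a * z ^ (b + k + 1)) *
          (algebraMap K L c' * (y ^ a * z ^ b))⁻¹ := by
        push_cast; field_simp; ring
      rw [e1, e2, map_mul, H, ← map_mul]
  rw [MvPolynomial.aeval_def, MvPolynomial.eval₂_eq'] at hp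
  simp only [Fin.prod_univ_two, Matrix.cons_val_zero, Matrix.cons_val_one] at hp
  obtain ⟨i, hi, j, hj, hij, hv⟩ := V.valuation.exists_ne_eq_of_sum_eq_zero
    (MvPolynomial.support_nonempty.2 hp0)
    (fun i hi ↦ by simpa [hy0, hz0] using hi) hp
  rw [MvPolynomial.mem_support_iff] at hi hj
  have hne : i 0 ≠ j 0 ∨ i 1 ≠ j 1 := by
    by_contra! hh
    exact hij (Finsupp.ext fun m ↦ by fin_cases m <;> simp [hh])
  rcases lt_trichotomy (i 0) (j 0) with h0 | h0 | h0
  · exact key _ _ _ _ _ _ hi hj (.inl h0) hv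
  · rcases lt_trichotomy (i 1) (j 1) with h1 | h1 | h1
    · exact key _ _ _ _ _ _ hi hj (.inr ⟨h0, h1⟩) hv
    · exact hne.elim (· h0) (· h1)
    · exact key _ _ _ _ _ _ hj hi (.inr ⟨h0.symm, h1⟩) hv.symm
  · exact key _ _ _ _ _ _ hj hi (.inl h0) hv.symm

end ValuationSubring

/-- A monotone map that never collapses two non-overlapping intervals `a < b ≤ c < d` lowers the
Krull dimension by at most one. -/
theorem Order.krullDim_le_krullDim_add_one_of_monotone {α β : Type*} [PartialOrder α]
    [PartialOrder β] {f : α → β} (hf : Monotone f)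
    (h : ∀ a b c d, a < b → b ≤ c → c < d → f a = f b → f c ≠ f d) :
    Order.krullDim α ≤ Order.krullDim β + 1 := by
  have bound (n : ℕ) (g : Fin (n + 1) → β) (hg : StrictMono g) :
      (n : WithBot ℕ∞) ≤ Order.krullDim β :=
    LTSeries.length_le_krullDim (LTSeries.mk n g hg)
  refine iSup_le fun ⟨m, g, hg⟩ ↦ ?_
  replace hg : StrictMono g := Fin.strictMono_iff_lt_succ.2 hg
  change (m : WithBot ℕ∞) ≤ _
  by_cases hs : StrictMono (f ∘ g)
  · exact (bound _ _ hs).trans (le_add_of_nonneg_right zero_le_one)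
  obtain _ | n := m
  · exact absurd (fun i j hij ↦ by omega) hs
  rw [Fin.strictMono_iff_lt_succ] at hs
  push Not at hs
  obtain ⟨j, hj⟩ := hs
  have hfg : Monotone (f ∘ g) := hf.comp hg.monotone
  have hj : f (g j.castSucc) = f (g j.succ) :=
    ((hfg j.castSucc_lt_succ.le).lt_or_eq).resolve_left hj
  have hjj := hg j.castSucc_lt_succ
  push_cast
  refine add_le_add_left (bound n (f ∘ g ∘ j.castSucc.succAbove) fun i i' hi ↦ ?_) 1
  have hlt := Fin.strictMono_succAbove j.castSucc hi
  have ha := Fin.succAbove_ne j.castSucc i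
  have ha' := Fin.succAbove_ne j.castSucc i'
  simp only [Function.comp_apply]
  generalize j.castSucc.succAbove i = a at *
  generalize j.castSucc.succAbove i' = a' at *
  refine (hfg hlt.le).lt_of_ne fun heq ↦ ?_
  simp only [Function.comp_apply] at heq
  rcases ha'.lt_or_gt with h1 | h1
  · exact h _ _ _ _ (hg hlt) (hg.monotone h1.le) hjj heq hj
  rcases ha.lt_or_gt with h2 | h2
  · exact h _ _ _ _ (hg h2) le_rfl hjj
      (le_antisymm (hfg h2.le) ((hfg h1.le).trans heq.ge)) hj
  · exact h _ _ _ _ hjj (hg.monotone (Fin.castSucc_lt_iff_succ_le.1 h2)) (hg hlt) hj heq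

theorem ValuationSubring.ringKrullDim_le_comap_add_one {K L : Type*} [Field K] [Field L]
    [Algebra K L] (hL : Algebra.trdeg K L ≤ 1) (V : ValuationSubring L) :
    ringKrullDim V ≤ ringKrullDim (V.comap (algebraMap K L)) + 1 := by
  refine Order.krullDim_le_krullDim_add_one_of_monotone
    (f := PrimeSpectrum.comap (V.comapInclusion (K := K)))
    (fun P Q h ↦ Ideal.comap_mono h) fun P₁ P₂ P₃ P₄ h₁₂ h₂₃ h₃₄ h h' ↦ ?_
  exact not_comap_le_and_comap_le hL h₁₂ h₂₃ h₃₄ congr(($h).asIdeal).ge congr(($h').asIdeal).ge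

theorem ringKrullDim_le_valuativeDim_of_valuationSubring {A : Type*} [CommRing A] [IsDomain A]
    (V : ValuationSubring (FractionRing A)) (hV : ∀ a, algebraMap A (FractionRing A) a ∈ V) :
    ringKrullDim V ≤ valuativeDim A :=
  le_iSup_of_le V.toSubring <| le_iSup_of_le (Set.range_subset_iff.2 hV) <|
    le_iSup_of_le (fun x _ ↦ V.mem_or_inv_mem x) le_rfl

theorem ringKrullDim_le_valuativeDim (A : Type*) [CommRing A] [IsDomain A] :
    ringKrullDim A ≤ valuativeDim A := by
  refine iSup_le fun s ↦ ?_
  obtain ⟨V, hV, h⟩ := exists_valuationSubring_natCast_le_ringKrullDim s.length s.strictMono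
    (algebraMap A (FractionRing A)) (by
      rw [(RingHom.injective_iff_ker_eq_bot _).1 (IsFractionRing.injective A (FractionRing A))]
      exact bot_le)
  exact h.trans (ringKrullDim_le_valuativeDim_of_valuationSubring V hV)

universe u in
theorem valuativeDim_le_add_one_of_trdeg_le_one {A R : Type u} [CommRing A] [IsDomain A]
    [CommRing R] [IsDomain R] [Algebra A R] [FaithfulSMul A R] (h : Algebra.trdeg A R ≤ 1) :
    valuativeDim R ≤ valuativeDim A + 1 := by
  let : Algebra (FractionRing A) (FractionRing R) := FractionRing.liftAlgebra A _
  have : IsScalarTower A (FractionRing A) (FractionRing R) :=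
    FractionRing.isScalarTower_liftAlgebra A _
  have htr : Algebra.trdeg (FractionRing A) (FractionRing R) ≤ 1 := by
    have h1 := trdeg_add_eq A (FractionRing A) (A := FractionRing R)
    have h2 := trdeg_add_eq A R (A := FractionRing R)
    have := IsLocalization.isAlgebraic (FractionRing A) (nonZeroDivisors A)
    have := IsLocalization.isAlgebraic (FractionRing R) (nonZeroDivisors R)
    rw [trdeg_eq_zero, zero_add] at h1
    rw [trdeg_eq_zero (R := R), add_zero] at h2
    rwa [h1, ← h2]
  refine iSup_le fun S ↦ iSup_le fun hS ↦ iSup_le fun hS' ↦ ?_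
  let V := ValuationSubring.ofSubring S fun x ↦ by
    by_cases hx : x = 0
    · exact .inl (hx ▸ S.zero_mem)
    · exact hS' x hx
  refine (V.ringKrullDim_le_comap_add_one htr).trans (add_le_add_left
    (ringKrullDim_le_valuativeDim_of_valuationSubring _ fun a ↦ ?_) 1)
  change algebraMap _ _ (algebraMap A (FractionRing A) a) ∈ S
  rw [← IsScalarTower.algebraMap_apply, IsScalarTower.algebraMap_apply A R]
  exact hS ⟨_, rfl⟩

theorem LaurentPolynomial.trdeg_of_isDomain (A : Type*) [CommRing A] [IsDomain A] :
    Algebra.trdeg A A[T;T⁻¹] = 1 := by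
  have : FaithfulSMul (Polynomial A) A[T;T⁻¹] :=
    (faithfulSMul_iff_algebraMap_injective _ _).2 Polynomial.toLaurent_injective
  have : IsScalarTower A (Polynomial A) A[T;T⁻¹] :=
    .of_algebraMap_eq fun a ↦ (Polynomial.toLaurent_C a).symm
  have h := trdeg_add_eq A (Polynomial A) (A := A[T;T⁻¹])
  have := IsLocalization.isAlgebraic A[T;T⁻¹] (Submonoid.powers (Polynomial.X : Polynomial A))
  rw [trdeg_eq_zero (R := Polynomial A), add_zero, Polynomial.trdeg_of_isDomain] at h
  exact h.symm

theorem ringKrullDim_add_one_le_symbolicReesAlgebra (A : Type*) [CommRing A] [IsDomain A]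
    (p : Ideal A) [p.IsPrime] :
    ringKrullDim A + 1 ≤ ringKrullDim (symbolicReesAlgebra A p) := by
  have hT : (T (-1) : A[T;T⁻¹]) ∈ symbolicReesAlgebra A p :=
    Algebra.subset_adjoin (.inl rfl)
  let ev : A[T;T⁻¹] →+* A := LaurentPolynomial.eval₂ (RingHom.id A) 1
  refine ringKrullDim_succ_le_of_surjective (ev.comp (symbolicReesAlgebra A p).subtype)
    (fun a ↦ ⟨algebraMap A _ a, ?_⟩) (r := ⟨T (-1), hT⟩ - 1)
    (mem_nonZeroDivisors_of_ne_zero fun h ↦ ?_) ?_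
  · simp [ev]
  · have h1 : (T (-1) : A[T;T⁻¹]) = T 0 := sub_eq_zero.1 congr(($h : A[T;T⁻¹]))
    exact absurd ((AddMonoidAlgebra.single_left_inj one_ne_zero).1 h1) (by decide)
  · simp [ev]

/-- Let `A` be a domain, `p` a prime of `A`, and `R` the symbolic Rees algebra
of `p`. If `A` is a Jaffard domain (`dim A = dim_v A < ∞`), then `R` is a Jaffard domain with
`dim R = 1 + dim A`. -/
theorem statement6 (A : Type*) [CommRing A] [IsDomain A] (p : Ideal A) [p.IsPrime]
    (hA : IsJaffard A) :
    IsJaffard ↥(symbolicReesAlgebra A p) ∧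
      ringKrullDim ↥(symbolicReesAlgebra A p) = 1 + ringKrullDim A := by
  obtain ⟨hdim, hfin⟩ := hA
  have htr : Algebra.trdeg A (symbolicReesAlgebra A p) ≤ 1 :=
    (trdeg_le_of_injective (symbolicReesAlgebra A p).val Subtype.val_injective).trans_eq
      (LaurentPolynomial.trdeg_of_isDomain A)
  have h1 := ringKrullDim_add_one_le_symbolicReesAlgebra A p
  have h2 := ringKrullDim_le_valuativeDim (symbolicReesAlgebra A p)
  have h3 := valuativeDim_le_add_one_of_trdeg_le_one htr
  rw [← hdim] at h3
  have h4 : ringKrullDim (symbolicReesAlgebra A p) = ringKrullDim A + 1 := (h2.trans h3).antisymm h1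
  refine ⟨⟨h2.antisymm (h3.trans h1), ?_⟩, h4.trans (add_comm _ _)⟩
  rw [h4]
  generalize ringKrullDim A = d at hfin
  cases d with
  | bot => simp
  | coe d => exact WithBot.coe_lt_coe.2 (ENat.add_lt_top.2 ⟨WithBot.coe_lt_coe.1 hfin, by simp⟩)
end
end

section
/- Let A be a Noetherian domain, p a prime of A of height n, and R the symbolic Rees algebra of p. Then the set of primes of R lying over (p,t⁻¹) in A[t⁻¹] is lattice-isomorphic to the spectrum of an n-dimensional finitely generated algebra over the field A_p/pA_p; in particular if n ≥ 2 there is a chain of length ≥ 2 of primes of R all lying over (p,t⁻¹). -/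
noncomputable section

open LaurentPolynomial

theorem ringKrullDim_adjoin_finset_le {R S : Type*} [CommRing R] [CommRing S] [IsDomain S]
    [IsNoetherianRing R] [Algebra R S] [FaithfulSMul R S] [Algebra.IsAlgebraic R S] (s : Finset S) :
    ringKrullDim (Algebra.adjoin R (s : Set S)) ≤ ringKrullDim R := by
  classical
  induction s using Finset.induction_on with
  | empty =>
    refine ringKrullDim_le_of_surjective (algebraMap R _) ?_
    rintro ⟨x, hx⟩
    simp only [Finset.coe_empty, Algebra.adjoin_empty, Algebra.mem_bot] at hx
    obtain ⟨r, rfl⟩ := hx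
    exact ⟨r, rfl⟩
  | insert x s _ ih =>
    refine le_trans ?_ ih
    have : Algebra.FiniteType R (Algebra.adjoin R (s : Set S)) :=
      (Subalgebra.fg_iff_finiteType _).mp (Subalgebra.fg_adjoin_finset s)
    have := Algebra.FiniteType.isNoetherianRing R (Algebra.adjoin R (s : Set S))
    set T := Algebra.adjoin R (s : Set S)
    let φ : Polynomial T →ₐ[T] S := Polynomial.aeval x
    have hle : ∀ y ∈ Algebra.adjoin R ((insert x s : Finset S) : Set S), y ∈ φ.range := by
      intro y hy
      have : Algebra.adjoin R ((insert x s : Finset S) : Set S) ≤ (φ.restrictScalars R).range := by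
        refine Algebra.adjoin_le ?_
        intro z hz
        rcases Finset.mem_insert.mp hz with rfl | hz
        · exact ⟨Polynomial.X, Polynomial.aeval_X z⟩
        · exact ⟨Polynomial.C ⟨z, Algebra.subset_adjoin hz⟩, Polynomial.aeval_C _ _⟩
      exact this hy
    have hge : ∀ f, φ f ∈ Algebra.adjoin R ((insert x s : Finset S) : Set S) := by
      intro f
      have hTle : T ≤ Algebra.adjoin R ((insert x s : Finset S) : Set S) :=
        Algebra.adjoin_mono (by simp)
      rw [show φ f = _ from Polynomial.aeval_eq_sum_range x]
      refine Subalgebra.sum_mem _ fun i _ => ?_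
      rw [Algebra.smul_def]
      exact Subalgebra.mul_mem _ (hTle (f.coeff i).2)
        (Subalgebra.pow_mem _ (Algebra.subset_adjoin (by simp)) _)
    let ψ : Polynomial T →+* Algebra.adjoin R ((insert x s : Finset S) : Set S) :=
      φ.toRingHom.codRestrict _ hge
    have hψ : Function.Surjective ψ := by
      rintro ⟨y, hy⟩
      obtain ⟨f, hf⟩ := hle y hy
      exact ⟨f, Subtype.ext hf⟩
    have hx : IsAlgebraic T x := by
      refine (Algebra.IsAlgebraic.isAlgebraic (R := R) x).extendScalars (S := T) ?_
      have h := FaithfulSMul.algebraMap_injective R S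
      rw [IsScalarTower.algebraMap_eq R T S, RingHom.coe_comp] at h
      exact Function.Injective.of_comp h
    obtain ⟨r, hr0, hr⟩ := hx
    have h1 : ringKrullDim (Polynomial T ⧸ Ideal.span {r}) + 1 ≤ ringKrullDim (Polynomial T) :=
      ringKrullDim_quotient_succ_le_of_nonZeroDivisor (mem_nonZeroDivisors_of_ne_zero hr0)
    rw [Polynomial.ringKrullDim_of_isNoetherianRing] at h1
    have h2 : ringKrullDim (Polynomial T ⧸ Ideal.span {r}) ≤ ringKrullDim T :=
      ENat.WithBot.add_le_add_one_right_iff.mp h1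
    refine (ringKrullDim_le_of_surjective (Ideal.Quotient.lift (Ideal.span {r}) ψ ?_) ?_).trans h2
    · intro a ha
      have : Ideal.span {r} ≤ RingHom.ker ψ := by
        rw [Ideal.span_singleton_le_iff_mem]
        exact Subtype.ext hr
      exact this ha
    · exact Ideal.Quotient.lift_surjective_of_surjective _ _ hψ

theorem ringKrullDim_le_of_finiteType_of_isAlgebraic (R S : Type*) [CommRing R] [CommRing S]
    [IsDomain S] [IsNoetherianRing R] [Algebra R S] [FaithfulSMul R S] [Algebra.IsAlgebraic R S]
    [Algebra.FiniteType R S] : ringKrullDim S ≤ ringKrullDim R := by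
  obtain ⟨s, hs⟩ := (Algebra.FiniteType.out : (⊤ : Subalgebra R S).FG)
  rw [← ringKrullDim_eq_of_ringEquiv (Subalgebra.topEquiv (R := R) (A := S)).toRingEquiv, ← hs]
  exact ringKrullDim_adjoin_finset_le s

namespace LaurentPolynomial

theorem mem_of_forall_C_mul_T_mem {R M : Type*} [Semiring R] [SetLike M R[T;T⁻¹]]
    [AddSubmonoidClass M R[T;T⁻¹]] {N : M} {f : R[T;T⁻¹]}
    (h : ∀ i : ℤ, C (f.coeff i) * T i ∈ N) : f ∈ N := by
  have hf : f.coeff.sum AddMonoidAlgebra.single = f := AddMonoidAlgebra.sum_coeff_single f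
  rw [← hf]
  refine sum_mem fun i _ => ?_
  rw [single_eq_C_mul_T]
  exact h i

theorem coeff_C_mul_T {R : Type*} [Semiring R] (a : R) (i j : ℤ) :
    (C a * T i : R[T;T⁻¹]).coeff j = if i = j then a else 0 := by
  rw [← single_eq_C_mul_T, AddMonoidAlgebra.coeff_single, Finsupp.single_apply]

theorem coeff_mul_T {R : Type*} [Semiring R] (f : R[T;T⁻¹]) (i j : ℤ) :
    (f * T i).coeff j = f.coeff (j - i) := by
  rw [T, AddMonoidAlgebra.coeff_mul_single_apply, mul_one, sub_eq_add_neg]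

theorem coeff_toLaurent_natCast {R : Type*} [Semiring R] (f : Polynomial R) (n : ℕ) :
    (Polynomial.toLaurent f).coeff (n : ℤ) = f.coeff n := by
  rw [coeff_toLaurent]
  exact Finsupp.mapDomain_apply Nat.cast_injective _ _

theorem coeff_C_mul {R : Type*} [Semiring R] (a : R) (f : R[T;T⁻¹]) (i : ℤ) :
    (C a * f).coeff i = a * f.coeff i := by
  rw [← single_eq_C, AddMonoidAlgebra.coeff_single_mul_apply, neg_zero, zero_add]

end LaurentPolynomial

/-- The extended Rees algebra `⊕_{n∈ℤ} Iⁿtⁿ` of an ideal `I`, where `Iⁿ = R` for `n ≤ 0`. -/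
def extendedReesAlgebra {R : Type*} [CommRing R] (I : Ideal R) : Subalgebra R R[T;T⁻¹] where
  carrier := {f | ∀ i : ℤ, f.coeff i ∈ I ^ i.toNat}
  add_mem' hf hg i := Ideal.add_mem _ (hf i) (hg i)
  mul_mem' {f g} hf hg i := by
    rw [AddMonoidAlgebra.coeff_mul]
    refine Ideal.sum_mem _ fun j _ => Ideal.sum_mem _ fun k _ => ?_
    dsimp only
    split_ifs with h
    · have hmem := Ideal.mul_mem_mul (hf j) (hg k)
      rw [← pow_add] at hmem
      exact Ideal.pow_le_pow_right (by lia) hmem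
    · exact Ideal.zero_mem _
  algebraMap_mem' r i := by
    rw [← C_eq_algebraMap, C_apply]
    split_ifs with h
    · simp [h]
    · exact Ideal.zero_mem _

namespace extendedReesAlgebra

variable {R : Type*} [CommRing R] {I : Ideal R}

theorem mem_iff {f : R[T;T⁻¹]} :
    f ∈ extendedReesAlgebra I ↔ ∀ i : ℤ, f.coeff i ∈ I ^ i.toNat :=
  Iff.rfl

theorem C_mul_T_mem {a : R} {i : ℤ} (ha : a ∈ I ^ i.toNat) :
    C a * T i ∈ extendedReesAlgebra I := by
  intro j
  rw [coeff_C_mul_T]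
  split_ifs with h
  · exact h ▸ ha
  · exact Ideal.zero_mem _

variable (I) in
/-- The element `t⁻¹` of the extended Rees algebra. -/
def tInv : extendedReesAlgebra I :=
  ⟨T (-1), by simpa using C_mul_T_mem (I := I) (a := 1) (i := -1) (by simp)⟩

variable (I) in
theorem coe_tInv_pow (n : ℕ) : ((tInv I ^ n : extendedReesAlgebra I) : R[T;T⁻¹]) = T (-n) := by
  simp [tInv, T_pow]

theorem eq_sup : extendedReesAlgebra I =
    (reesAlgebra I).map Polynomial.toLaurentAlg ⊔ Algebra.adjoin R {T (-1)} := by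
  refine le_antisymm (fun f hf => mem_of_forall_C_mul_T_mem fun i => ?_)
    (sup_le ?_ (Algebra.adjoin_le ?_))
  · obtain ⟨n, rfl | rfl⟩ := i.eq_nat_or_neg
    · refine Algebra.mem_sup_left (Subalgebra.mem_map.mpr ⟨Polynomial.monomial n (f.coeff n),
        reesAlgebra.monomial_mem.mpr ?_, ?_⟩)
      · have h := hf n
        rwa [Int.toNat_natCast] at h
      · rw [Polynomial.toLaurentAlg_apply, ← Polynomial.C_mul_X_pow_eq_monomial,
          Polynomial.toLaurent_C_mul_X_pow]
    · refine Algebra.mem_sup_right ?_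
      have h : (T (-1) : R[T;T⁻¹]) ^ n = T (-n) := by simp [T_pow]
      have hT : (T (-1) : R[T;T⁻¹]) ∈ Algebra.adjoin R {(T (-1) : R[T;T⁻¹])} :=
        Algebra.self_mem_adjoin_singleton R _
      rw [C_eq_algebraMap, ← h]
      exact mul_mem (algebraMap_mem _ _) (pow_mem hT _)
  · intro g hg
    obtain ⟨f, hf, rfl⟩ := Subalgebra.mem_map.mp hg
    refine mem_of_forall_C_mul_T_mem fun i => C_mul_T_mem ?_
    obtain ⟨n, rfl | rfl⟩ := i.eq_nat_or_neg
    · rw [Polynomial.toLaurentAlg_apply, coeff_toLaurent_natCast, Int.toNat_natCast]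
      exact hf n
    · simp
  · rw [Set.singleton_subset_iff]
    exact (tInv I).2

theorem fg [IsNoetherianRing R] : (extendedReesAlgebra I).FG := by
  rw [eq_sup]
  exact ((reesAlgebra.fg (IsNoetherian.noetherian I)).map _).sup
    (Subalgebra.fg_def.mpr ⟨_, Set.finite_singleton _, rfl⟩)

instance [IsNoetherianRing R] : Algebra.FiniteType R (extendedReesAlgebra I) :=
  (Subalgebra.fg_iff_finiteType _).mp fg

theorem ringKrullDim_le [IsDomain R] [IsNoetherianRing R] :
    ringKrullDim (extendedReesAlgebra I) ≤ ringKrullDim R + 1 := by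
  rw [← Polynomial.ringKrullDim_of_isNoetherianRing]
  let φ : Polynomial R →ₐ[R] extendedReesAlgebra I := Polynomial.aeval (tInv I)
  let _ : Algebra (Polynomial R) (extendedReesAlgebra I) := φ.toRingHom.toAlgebra
  have hφ (f : Polynomial R) : ((φ f : extendedReesAlgebra I) : R[T;T⁻¹]) =
      invert (Polynomial.toLaurent f) := by
    induction f using Polynomial.induction_on' with
    | add f g hf hg => simp [hf, hg]
    | monomial n a =>
      rw [Polynomial.aeval_monomial, ← Polynomial.C_mul_X_pow_eq_monomial,
        Polynomial.toLaurent_C_mul_X_pow, map_mul, invert_C, invert_T, MulMemClass.coe_mul,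
        coe_tInv_pow, C_eq_algebraMap]
      rfl
  have : IsScalarTower R (Polynomial R) (extendedReesAlgebra I) :=
    .of_algebraMap_eq fun r => (φ.commutes r).symm
  have : Algebra.FiniteType (Polynomial R) (extendedReesAlgebra I) :=
    .of_restrictScalars_finiteType R _ _
  have hinj : Function.Injective φ := by
    intro f g hfg
    have h := congrArg Subtype.val hfg
    rw [hφ, hφ] at h
    exact Polynomial.toLaurent_injective (invert.injective h)
  have : FaithfulSMul (Polynomial R) (extendedReesAlgebra I) :=
    (faithfulSMul_iff_algebraMap_injective _ _).mpr hinj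
  have : Algebra.IsAlgebraic (Polynomial R) (extendedReesAlgebra I) := by
    refine ⟨fun x => ?_⟩
    obtain ⟨n, g, hg⟩ := exists_T_pow (invert (x : R[T;T⁻¹]))
    have hx : φ (Polynomial.X ^ n) * x = φ g := by
      refine Subtype.ext ?_
      rw [hφ, hg, map_mul, invert_T, MulMemClass.coe_mul, hφ, Polynomial.toLaurent_X_pow, invert_T,
        mul_comm]
      exact congrArg (· * T (-n : ℤ)) (involutive_invert (x : R[T;T⁻¹])).symm
    refine ⟨Polynomial.C (Polynomial.X ^ n) * Polynomial.X - Polynomial.C g, ?_, ?_⟩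
    · intro h
      have := congrArg (Polynomial.coeff · 1) h
      simp only [Polynomial.coeff_sub, Polynomial.coeff_C_mul, Polynomial.coeff_X_one, mul_one,
        Polynomial.coeff_C_of_ne_zero one_ne_zero, sub_zero, Polynomial.coeff_zero] at this
      exact pow_ne_zero n Polynomial.X_ne_zero this
    · simp only [map_sub, map_mul, Polynomial.aeval_C, Polynomial.aeval_X]
      exact sub_eq_zero.mpr hx
  exact ringKrullDim_le_of_finiteType_of_isAlgebraic _ _

variable (I) in
/-- The contraction of `q R[t, t⁻¹]` to the extended Rees algebra. -/
def contraction (q : Ideal R) : Ideal (extendedReesAlgebra I) :=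
  RingHom.ker ((AddMonoidAlgebra.mapRingHom ℤ (Ideal.Quotient.mk q)).comp
    (extendedReesAlgebra I).val.toRingHom)

theorem mem_contraction {q : Ideal R} {x : extendedReesAlgebra I} :
    x ∈ contraction I q ↔ ∀ i, (x : R[T;T⁻¹]).coeff i ∈ q := by
  rw [contraction, RingHom.mem_ker, LaurentPolynomial.ext_iff]
  refine forall_congr' fun i => ?_
  rw [← Ideal.Quotient.eq_zero_iff_mem, RingHom.comp_apply, AddMonoidAlgebra.coeff_mapRingHom]
  rfl

instance (q : Ideal R) [q.IsPrime] : (contraction I q).IsPrime :=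
  RingHom.ker_isPrime _

theorem contraction_le_contraction {q q' : Ideal R} :
    contraction I q ≤ contraction I q' ↔ q ≤ q' := by
  refine ⟨fun h a ha => ?_, fun h x hx => mem_contraction.mpr fun i => h (mem_contraction.mp hx i)⟩
  have hcoeff (i : ℤ) : ((algebraMap R (extendedReesAlgebra I) a : extendedReesAlgebra I) :
      R[T;T⁻¹]).coeff i = if i = 0 then a else 0 := by
    rw [← C_apply, C_eq_algebraMap]
    rfl
  have hmem : algebraMap R (extendedReesAlgebra I) a ∈ contraction I q := by
    refine mem_contraction.mpr fun i => ?_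
    rw [hcoeff]
    split_ifs
    exacts [ha, q.zero_mem]
  simpa [hcoeff] using mem_contraction.mp (h hmem) 0

theorem height_le_height_contraction (q : Ideal R) [q.IsPrime] :
    q.height ≤ (contraction I q).height := by
  let f (q : PrimeSpectrum R) : PrimeSpectrum (extendedReesAlgebra I) :=
    ⟨contraction I q.asIdeal, inferInstance⟩
  have hf : StrictMono f := fun q q' h =>
    lt_of_le_not_ge (contraction_le_contraction.mpr h.le)
      fun h' => h.not_ge (contraction_le_contraction.mp h')
  let x : PrimeSpectrum R := ⟨q, inferInstance⟩
  have h := Order.height_le_height_apply_of_strictMono f hf x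
  rwa [← PrimeSpectrum.height_eq_orderHeight, ← PrimeSpectrum.height_eq_orderHeight] at h

theorem coeff_tInv_mul (x : extendedReesAlgebra I) (i : ℤ) :
    ((tInv I * x : extendedReesAlgebra I) : R[T;T⁻¹]).coeff i = (x : R[T;T⁻¹]).coeff (i + 1) := by
  rw [mul_comm, MulMemClass.coe_mul, tInv, coeff_mul_T, sub_neg_eq_add]

theorem coe_algebraMap (a : R) :
    ((algebraMap R (extendedReesAlgebra I) a : extendedReesAlgebra I) : R[T;T⁻¹]) = C a :=
  rfl

theorem algebraMap_mem_span_tInv {a : R} (ha : a ∈ I) :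
    algebraMap R (extendedReesAlgebra I) a ∈ Ideal.span {tInv I} := by
  refine Ideal.mem_span_singleton'.mpr ⟨⟨C a * T 1, C_mul_T_mem (by simpa)⟩, Subtype.ext ?_⟩
  rw [MulMemClass.coe_mul, coe_algebraMap, tInv, mul_T_assoc]
  simp

theorem ringKrullDim_quotient_tInv (R : Type*) [CommRing R] [IsDomain R] [IsNoetherianRing R]
    [IsLocalRing R] :
    ringKrullDim (extendedReesAlgebra (IsLocalRing.maximalIdeal R) ⧸
      Ideal.span {tInv (IsLocalRing.maximalIdeal R)}) = ringKrullDim R := by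
  set m := IsLocalRing.maximalIdeal R
  have : IsNoetherianRing (extendedReesAlgebra m) := Algebra.FiniteType.isNoetherianRing R _
  have hne : contraction m m ⊔ Ideal.span {tInv m} ≠ ⊤ := by
    rw [Ne, Ideal.eq_top_iff_one, Submodule.mem_sup]
    rintro ⟨f, hf, g, hg, hfg⟩
    obtain ⟨x, rfl⟩ := Ideal.mem_span_singleton.mp hg
    have h := congrArg (fun y : extendedReesAlgebra m => (y : R[T;T⁻¹]).coeff 0) hfg
    have h1 := mem_iff.mp x.2 1
    rw [Int.toNat_one, pow_one] at h1
    have h0 := mem_contraction.mp hf 0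
    have h2 : (f : R[T;T⁻¹]).coeff 0 + (x : R[T;T⁻¹]).coeff 1 = 1 := by
      rw [← zero_add (1 : ℤ), ← coeff_tInv_mul]
      refine h.trans ?_
      change (1 : R[T;T⁻¹]).coeff 0 = 1
      rw [← T_zero, T_apply, if_pos rfl]
    exact (Ideal.ne_top_iff_one m).mp (Ideal.IsPrime.ne_top inferInstance)
      (h2 ▸ m.add_mem h0 h1)
  obtain ⟨M, hM, hle⟩ := Ideal.exists_le_maximal _ hne
  have hMu : tInv m ∈ M := hle (Ideal.mem_sup_right (Ideal.mem_span_singleton_self _))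
  have hlt : contraction m m < M := by
    refine lt_of_le_of_ne (le_sup_left.trans hle) fun h => ?_
    rw [← h] at hMu
    have h1 := mem_contraction.mp hMu (-1)
    rw [tInv, T_apply, if_pos rfl] at h1
    exact (Ideal.ne_top_iff_one m).mp (Ideal.IsPrime.ne_top inferInstance) h1
  have : (M.map (Ideal.Quotient.mk (Ideal.span {tInv m}))).IsPrime :=
    Ideal.map_isPrime_of_surjective Ideal.Quotient.mk_surjective (by
      rwa [Ideal.mk_ker, Ideal.span_singleton_le_iff_mem])
  apply le_antisymm
  · have h0 : tInv m ≠ 0 := by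
      intro h
      have := congrArg (fun y : extendedReesAlgebra m => (y : R[T;T⁻¹]).coeff (-1)) h
      simp [tInv] at this
    exact ENat.WithBot.add_le_add_one_right_iff.mp
      ((ringKrullDim_quotient_succ_le_of_nonZeroDivisor (mem_nonZeroDivisors_of_ne_zero h0)).trans
        ringKrullDim_le)
  · have h := (Ideal.height_add_one_le_of_lt_of_isPrime hlt).trans
      (Ideal.height_le_height_add_one_of_mem hMu)
    have h' := (height_le_height_contraction (I := m) m).trans
      ((ENat.add_le_add_iff_right ENat.one_ne_top).mp h)
    rw [← IsLocalRing.maximalIdeal_height_eq_ringKrullDim]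
    exact (WithBot.coe_le_coe.mpr h').trans Ideal.height_le_ringKrullDim_of_isPrime

end extendedReesAlgebra

theorem IsLocalization.nonempty_orderIso_primeSpectrum_quotient {R S : Type*} [CommRing R]
    [CommRing S] [Algebra R S] (M : Submonoid R) [IsLocalization M S] (u : R)
    {Q : Ideal R → Prop}
    (hQ : ∀ P, Q P ↔ P.IsPrime ∧ Disjoint (M : Set R) (P : Set R) ∧ u ∈ P) :
    Nonempty ({P : Ideal R // Q P} ≃o PrimeSpectrum (S ⧸ Ideal.span {algebraMap R S u})) := by
  let e := IsLocalization.orderIsoOfPrime M S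
  let J := Ideal.span {algebraMap R S u}
  let c : PrimeSpectrum (S ⧸ J) → {P : Ideal S // P.IsPrime} := fun x =>
    ⟨x.asIdeal.comap (Ideal.Quotient.mk J), inferInstance⟩
  have hc (x y) : c x ≤ c y ↔ x ≤ y := by
    refine ⟨fun h => ?_, fun h => Ideal.comap_mono h⟩
    exact (Ideal.comap_le_comap_iff_of_surjective _ Ideal.Quotient.mk_surjective _ _).mp h
  have hu (x) : u ∈ (e (c x)).1 := by
    change Ideal.Quotient.mk J (algebraMap R S u) ∈ x.asIdeal
    rw [Ideal.Quotient.eq_zero_iff_mem.mpr (Ideal.mem_span_singleton_self _)]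
    exact x.asIdeal.zero_mem
  let f : PrimeSpectrum (S ⧸ J) → {P : Ideal R // Q P} := fun x =>
    ⟨(e (c x)).1, (hQ _).mpr ⟨(e (c x)).2.1, (e (c x)).2.2, hu x⟩⟩
  have hf (x y) : f x ≤ f y ↔ x ≤ y := (e.le_iff_le (x := c x) (y := c y)).trans (hc x y)
  refine ⟨(RelIso.ofSurjective (OrderEmbedding.ofMapLEIff f hf) ?_).symm⟩
  rintro ⟨P, hP⟩
  obtain ⟨hP₁, hP₂, hP₃⟩ := (hQ P).mp hP
  obtain ⟨N, hN⟩ := e.surjective ⟨P, hP₁, hP₂⟩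
  have huN : algebraMap R S u ∈ N.1 := by
    change u ∈ (e N).1
    rwa [hN]
  have hJN : J ≤ N.1 := (Ideal.span_singleton_le_iff_mem _).mpr huN
  obtain ⟨x, hx⟩ := (Ideal.primeSpectrumQuotientOrderIsoZeroLocus J).surjective ⟨⟨N.1, N.2⟩, hJN⟩
  refine ⟨x, Subtype.ext ?_⟩
  have hcx : c x = N := Subtype.ext (congrArg (fun y => y.1.asIdeal) hx)
  change (e (c x)).1 = P
  rw [hcx, hN]

section SymbolicReesAlgebra

variable {A : Type*} [CommRing A] (p : Ideal A) [p.IsPrime]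

theorem mem_symbolicPower {a : A} {n : ℕ} : a ∈ symbolicPower A p n ↔
    algebraMap A (Localization.AtPrime p) a ∈
      IsLocalRing.maximalIdeal (Localization.AtPrime p) ^ n := by
  rw [symbolicPower, Ideal.mem_comap, Ideal.map_pow, Localization.AtPrime.map_eq_maximalIdeal]

theorem mem_symbolicReesAlgebra {f : A[T;T⁻¹]} : f ∈ symbolicReesAlgebra A p ↔
    AddMonoidAlgebra.mapRingHom ℤ (algebraMap A (Localization.AtPrime p)) f ∈
      extendedReesAlgebra (IsLocalRing.maximalIdeal (Localization.AtPrime p)) := by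
  have hC (a : A) (i : ℤ) : AddMonoidAlgebra.mapRingHom ℤ (algebraMap A (Localization.AtPrime p))
      (C a * T i) = C (algebraMap A (Localization.AtPrime p) a) * T i := by
    rw [← single_eq_C_mul_T, AddMonoidAlgebra.mapRingHom_single, single_eq_C_mul_T]
  constructor
  · intro hf
    induction hf using Algebra.adjoin_induction with
    | mem x hx =>
      rcases hx with rfl | hx
      · rw [← one_mul (T (-1)), ← map_one C, hC]
        exact extendedReesAlgebra.C_mul_T_mem (by simp)
      · obtain ⟨n, a, ha, rfl⟩ := Set.mem_iUnion.mp hx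
        rw [hC]
        exact extendedReesAlgebra.C_mul_T_mem ((mem_symbolicPower p).mp ha)
    | algebraMap r =>
      rw [← C_eq_algebraMap, ← mul_one (C r), ← T_zero, hC]
      exact extendedReesAlgebra.C_mul_T_mem (by simp)
    | add x y _ _ hx hy => rw [map_add]; exact add_mem hx hy
    | mul x y _ _ hx hy => rw [map_mul]; exact mul_mem hx hy
  · refine fun hf => mem_of_forall_C_mul_T_mem fun i => ?_
    obtain ⟨n, rfl | rfl⟩ := i.eq_nat_or_neg
    · have h := hf n
      rw [AddMonoidAlgebra.coeff_mapRingHom, Int.toNat_natCast] at h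
      exact Algebra.subset_adjoin (Or.inr (Set.mem_iUnion.mpr
        ⟨n, _, (mem_symbolicPower p).mpr h, rfl⟩))
    · have h : (T (-1) : A[T;T⁻¹]) ^ n = T (-n) := by simp [T_pow]
      have hT : (T (-1) : A[T;T⁻¹]) ∈ symbolicReesAlgebra A p :=
        Algebra.subset_adjoin (Or.inl rfl)
      rw [C_eq_algebraMap, ← h]
      exact mul_mem (algebraMap_mem _ _) (pow_mem hT _)

/-- The map from the symbolic Rees algebra of `p` to the extended Rees algebra of `pA_p`. -/
def symbolicReesAlgebraToLocal : symbolicReesAlgebra A p →+*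
    extendedReesAlgebra (IsLocalRing.maximalIdeal (Localization.AtPrime p)) :=
  ((AddMonoidAlgebra.mapRingHom ℤ (algebraMap A (Localization.AtPrime p))).comp
    (symbolicReesAlgebra A p).val.toRingHom).codRestrict _
    fun x => (mem_symbolicReesAlgebra p).mp x.2

instance : Algebra (symbolicReesAlgebra A p)
    (extendedReesAlgebra (IsLocalRing.maximalIdeal (Localization.AtPrime p))) :=
  (symbolicReesAlgebraToLocal p).toAlgebra

theorem coeff_algebraMap_symbolicReesAlgebra (x : symbolicReesAlgebra A p) (i : ℤ) :
    ((algebraMap (symbolicReesAlgebra A p)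
      (extendedReesAlgebra (IsLocalRing.maximalIdeal (Localization.AtPrime p))) x :
      extendedReesAlgebra (IsLocalRing.maximalIdeal (Localization.AtPrime p))) :
      (Localization.AtPrime p)[T;T⁻¹]).coeff i =
    algebraMap A (Localization.AtPrime p) ((x : A[T;T⁻¹]).coeff i) :=
  AddMonoidAlgebra.coeff_mapRingHom _ _ _

theorem algebraMap_algebraMap_symbolicReesAlgebra (a : A) :
    algebraMap (symbolicReesAlgebra A p)
      (extendedReesAlgebra (IsLocalRing.maximalIdeal (Localization.AtPrime p)))
      (algebraMap A (symbolicReesAlgebra A p) a) =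
    algebraMap (Localization.AtPrime p) _ (algebraMap A (Localization.AtPrime p) a) := by
  refine Subtype.ext (LaurentPolynomial.ext fun i => ?_)
  rw [coeff_algebraMap_symbolicReesAlgebra, extendedReesAlgebra.coe_algebraMap, C_apply]
  change algebraMap A _ ((algebraMap A A[T;T⁻¹] a).coeff i) = _
  rw [← C_eq_algebraMap, C_apply, apply_ite (algebraMap A (Localization.AtPrime p)), map_zero]

instance [IsDomain A] : IsLocalization
    (Algebra.algebraMapSubmonoid (symbolicReesAlgebra A p) p.primeCompl)
    (extendedReesAlgebra (IsLocalRing.maximalIdeal (Localization.AtPrime p))) := by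
  have hinj : Function.Injective (algebraMap A (Localization.AtPrime p)) :=
    IsLocalization.injective _ p.primeCompl_le_nonZeroDivisors
  refine (isLocalization_iff _ _).mpr ⟨?_, fun y => ?_, fun {x y} h => ⟨1, ?_⟩⟩
  · rintro ⟨_, s, hs, rfl⟩
    rw [algebraMap_algebraMap_symbolicReesAlgebra]
    exact (IsLocalization.map_units (Localization.AtPrime p) (⟨s, hs⟩ : p.primeCompl)).map _
  · obtain ⟨b, hb⟩ := IsLocalization.exist_integer_multiples p.primeCompl
      (y : (Localization.AtPrime p)[T;T⁻¹]).coeff.support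
      (y : (Localization.AtPrime p)[T;T⁻¹]).coeff
    have hb' (i : ℤ) : ∃ a, algebraMap A (Localization.AtPrime p) a =
        (b : A) • (y : (Localization.AtPrime p)[T;T⁻¹]).coeff i := by
      by_cases hi : i ∈ (y : (Localization.AtPrime p)[T;T⁻¹]).coeff.support
      · exact hb i hi
      · exact ⟨0, by rw [Finsupp.notMem_support_iff.mp hi, map_zero, smul_zero]⟩
    choose a ha using hb'
    let f : A[T;T⁻¹] := .ofCoeff (Finsupp.onFinset
        (y : (Localization.AtPrime p)[T;T⁻¹]).coeff.support a fun i hi => by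
      rw [Finsupp.mem_support_iff]
      intro h
      refine hi (hinj ?_)
      rw [ha, h, smul_zero, map_zero])
    have hf : f ∈ symbolicReesAlgebra A p := by
      rw [mem_symbolicReesAlgebra]
      intro i
      rw [AddMonoidAlgebra.coeff_mapRingHom]
      change algebraMap _ _ (a i) ∈ _
      rw [ha, Algebra.smul_def]
      exact Ideal.mul_mem_left _ _ (y.2 i)
    refine ⟨⟨⟨f, hf⟩, ⟨algebraMap A _ b, b, b.2, rfl⟩⟩,
      Subtype.ext (LaurentPolynomial.ext fun i => ?_)⟩
    rw [coeff_algebraMap_symbolicReesAlgebra, algebraMap_algebraMap_symbolicReesAlgebra, mul_comm,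
      MulMemClass.coe_mul, extendedReesAlgebra.coe_algebraMap, coeff_C_mul, ← Algebra.smul_def]
    exact (ha i).symm
  · congr 1
    refine Subtype.ext (LaurentPolynomial.ext fun i => hinj ?_)
    rw [← coeff_algebraMap_symbolicReesAlgebra, ← coeff_algebraMap_symbolicReesAlgebra, h]

theorem comap_aeval_eq_iff {ti : symbolicReesAlgebra A p} (hti : (ti : A[T;T⁻¹]) = T (-1))
    (P : Ideal (symbolicReesAlgebra A p)) :
    (P.IsPrime ∧ P.comap (Polynomial.aeval ti : Polynomial A →ₐ[A] symbolicReesAlgebra A p) =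
      p.map Polynomial.C ⊔ Ideal.span {Polynomial.X}) ↔
    P.IsPrime ∧ Disjoint
      (Algebra.algebraMapSubmonoid (symbolicReesAlgebra A p) p.primeCompl :
        Set (symbolicReesAlgebra A p)) P ∧
      ti ∈ P := by
  have hC (a : A) : Polynomial.aeval ti (Polynomial.C a) = algebraMap A _ a :=
    Polynomial.aeval_C _ _
  have hmem {f : Polynomial A} (hf : f ∈ p.map Polynomial.C ⊔ Ideal.span {Polynomial.X}) :
      f.coeff 0 ∈ p := by
    have hle : p.map Polynomial.C ⊔ Ideal.span {Polynomial.X} ≤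
        p.comap Polynomial.constantCoeff := by
      refine sup_le (Ideal.map_le_iff_le_comap.mpr fun a ha => ?_) ?_
      · simpa using ha
      · simp
    exact hle hf
  refine and_congr_right fun hP => ⟨fun h => ⟨?_, ?_⟩, fun ⟨hdisj, hu⟩ => le_antisymm ?_ ?_⟩
  · rw [Set.disjoint_left]
    rintro _ ⟨s, hs, rfl⟩ hsP
    have hs' : Polynomial.C s ∈ P.comap (Polynomial.aeval ti) := by
      rw [Ideal.mem_comap, hC]
      exact hsP
    rw [h] at hs'
    exact hs (by simpa using hmem hs')
  · have hX : (Polynomial.X : Polynomial A) ∈ P.comap (Polynomial.aeval ti) := by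
      rw [h]
      exact Ideal.mem_sup_right (Ideal.mem_span_singleton_self _)
    rwa [Ideal.mem_comap, Polynomial.aeval_X] at hX
  · intro f hf
    have hX : f.divX * Polynomial.X ∈ P.comap (Polynomial.aeval ti) := by
      rw [Ideal.mem_comap, map_mul, Polynomial.aeval_X]
      exact P.mul_mem_left _ hu
    have h0 : Polynomial.C (f.coeff 0) ∈ P.comap (Polynomial.aeval ti) := by
      rw [← Polynomial.divX_mul_X_add f] at hf
      exact (Ideal.add_mem_iff_right _ hX).mp hf
    rw [Ideal.mem_comap, hC] at h0
    have hp : f.coeff 0 ∈ p := by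
      by_contra hp
      exact Set.disjoint_left.mp hdisj ⟨_, hp, rfl⟩ h0
    rw [← Polynomial.divX_mul_X_add f]
    exact add_mem (Ideal.mem_sup_right (Ideal.mem_span_singleton'.mpr ⟨_, rfl⟩))
      (Ideal.mem_sup_left (Ideal.mem_map_of_mem _ hp))
  · refine sup_le (Ideal.map_le_iff_le_comap.mpr fun a ha => ?_) ?_
    · rw [Ideal.mem_comap, Ideal.mem_comap, hC]
      have hy : C a * T 1 ∈ symbolicReesAlgebra A p := by
        refine Algebra.subset_adjoin (Or.inr (Set.mem_iUnion.mpr ⟨1, a, ?_, rfl⟩))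
        exact Ideal.mem_comap.mpr (Ideal.mem_map_of_mem _ (by simpa using ha))
      have h : algebraMap A (symbolicReesAlgebra A p) a = ⟨_, hy⟩ * ti := by
        refine Subtype.ext ?_
        rw [MulMemClass.coe_mul, hti, mul_T_assoc, add_neg_cancel, T_zero, mul_one]
        rfl
      rw [h]
      exact P.mul_mem_left _ hu
    · rw [Ideal.span_singleton_le_iff_mem, Ideal.mem_comap, Polynomial.aeval_X]
      exact hu

end SymbolicReesAlgebra

namespace extendedReesAlgebra

/-- The associated graded ring `⊕ Iⁿ/Iⁿ⁺¹`, as the quotient of the extended Rees algebra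
by `t⁻¹`. -/
def AssociatedGraded {R : Type*} [CommRing R] (I : Ideal R) : Type _ :=
  extendedReesAlgebra I ⧸ Ideal.span {tInv I}

instance {R : Type*} [CommRing R] (I : Ideal R) : CommRing (AssociatedGraded I) :=
  inferInstanceAs (CommRing (extendedReesAlgebra I ⧸ Ideal.span {tInv I}))

variable (R : Type*) [CommRing R]

instance (I : Ideal R) : Algebra R (AssociatedGraded I) :=
  ((Ideal.Quotient.mk (Ideal.span {tInv I})).comp (algebraMap R _)).toAlgebra

instance [IsLocalRing R] : Algebra (IsLocalRing.ResidueField R)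
    (AssociatedGraded (IsLocalRing.maximalIdeal R)) :=
  (Ideal.Quotient.lift (IsLocalRing.maximalIdeal R) (algebraMap R _)
    fun _ ha => Ideal.Quotient.eq_zero_iff_mem.mpr (algebraMap_mem_span_tInv ha) :
    IsLocalRing.ResidueField R →+* AssociatedGraded (IsLocalRing.maximalIdeal R)).toAlgebra

instance [IsLocalRing R] : IsScalarTower R (IsLocalRing.ResidueField R)
    (AssociatedGraded (IsLocalRing.maximalIdeal R)) :=
  .of_algebraMap_eq fun _ => rfl

instance [IsLocalRing R] [IsNoetherianRing R] : Algebra.FiniteType (IsLocalRing.ResidueField R)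
    (AssociatedGraded (IsLocalRing.maximalIdeal R)) :=
  have : Algebra.FiniteType R (AssociatedGraded (IsLocalRing.maximalIdeal R)) :=
    .of_surjective (A := extendedReesAlgebra (IsLocalRing.maximalIdeal R))
      { toRingHom := Ideal.Quotient.mk _, commutes' := fun _ => rfl } Ideal.Quotient.mk_surjective
  .of_restrictScalars_finiteType R _ _

end extendedReesAlgebra

/-- Let `A` be a Noetherian domain, `p` a prime of `A` of height `n`, and `R`
the symbolic Rees algebra of `p`. Then the set of primes of `R` lying over `(p,t⁻¹)` in
`A[t⁻¹]` is lattice-isomorphic to the spectrum of an `n`-dimensional finitely generated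
algebra over the field `A_p/pA_p`; in particular if `n ≥ 2` there is a chain of length `≥ 2`
of primes of `R` all lying over `(p,t⁻¹)`. -/
theorem statement10 (A : Type) [CommRing A] [IsDomain A] [IsNoetherianRing A]
    (p : Ideal A) [hp : p.IsPrime] (n : ℕ)
    (hn : Order.height (⟨p, hp⟩ : PrimeSpectrum A) = n)
    (ti : ↥(symbolicReesAlgebra A p))
    (hti : (ti : LaurentPolynomial A) = T (-1)) :
    (∃ (B : Type) (_ : CommRing B)
        (_ : Algebra (IsLocalRing.ResidueField (Localization.AtPrime p)) B),
        Algebra.FiniteType (IsLocalRing.ResidueField (Localization.AtPrime p)) B ∧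
        ringKrullDim B = (n : WithBot ℕ∞) ∧
        Nonempty
          ({P : Ideal ↥(symbolicReesAlgebra A p) // P.IsPrime ∧
              Ideal.comap
                (Polynomial.aeval ti : Polynomial A →ₐ[A] ↥(symbolicReesAlgebra A p)) P =
                Ideal.map Polynomial.C p ⊔ Ideal.span {Polynomial.X}} ≃o
            PrimeSpectrum B)) ∧
    (2 ≤ n →
      ∃ P₀ P₁ P₂ : Ideal ↥(symbolicReesAlgebra A p),
        (P₀.IsPrime ∧ P₁.IsPrime ∧ P₂.IsPrime) ∧
        (∀ P ∈ ({P₀, P₁, P₂} : Set (Ideal ↥(symbolicReesAlgebra A p))),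
          Ideal.comap
            (Polynomial.aeval ti : Polynomial A →ₐ[A] ↥(symbolicReesAlgebra A p)) P =
            Ideal.map Polynomial.C p ⊔ Ideal.span {Polynomial.X}) ∧
        P₀ < P₁ ∧ P₁ < P₂) := by
  have hiso : Nonempty ({P : Ideal ↥(symbolicReesAlgebra A p) // P.IsPrime ∧
      Ideal.comap (Polynomial.aeval ti : Polynomial A →ₐ[A] ↥(symbolicReesAlgebra A p)) P =
        Ideal.map Polynomial.C p ⊔ Ideal.span {Polynomial.X}} ≃o _) :=
    IsLocalization.nonempty_orderIso_primeSpectrum_quotient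
      (S := extendedReesAlgebra (IsLocalRing.maximalIdeal (Localization.AtPrime p)))
      _ ti (comap_aeval_eq_iff p hti)
  have hti' : algebraMap (symbolicReesAlgebra A p)
      (extendedReesAlgebra (IsLocalRing.maximalIdeal (Localization.AtPrime p))) ti =
      extendedReesAlgebra.tInv _ := by
    refine Subtype.ext (LaurentPolynomial.ext fun i => ?_)
    rw [coeff_algebraMap_symbolicReesAlgebra, hti, extendedReesAlgebra.tInv, T_apply, T_apply,
      apply_ite (algebraMap A (Localization.AtPrime p)), map_one, map_zero]
  rw [hti'] at hiso
  have : IsNoetherianRing (Localization.AtPrime p) :=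
    IsLocalization.isNoetherianRing p.primeCompl _ inferInstance
  have : IsDomain (Localization.AtPrime p) :=
    IsLocalization.isDomain_localization p.primeCompl_le_nonZeroDivisors
  have hdim := extendedReesAlgebra.ringKrullDim_quotient_tInv (Localization.AtPrime p)
  rw [IsLocalization.AtPrime.ringKrullDim_eq_height p (Localization.AtPrime p),
    (PrimeSpectrum.height_eq_orderHeight ⟨p, hp⟩).trans hn] at hdim
  refine ⟨?_, fun h2 => ?_⟩
  · exact ⟨extendedReesAlgebra.AssociatedGraded
      (IsLocalRing.maximalIdeal (Localization.AtPrime p)), inferInstance, inferInstance,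
      inferInstance, hdim, hiso⟩
  · obtain ⟨e⟩ := hiso
    have hle : ((2 : ℕ) : WithBot ℕ∞) ≤ Order.krullDim _ :=
      (Nat.cast_le.mpr h2).trans hdim.ge
    obtain ⟨l, hl⟩ := Order.le_krullDim_iff.mp hle
    let P (i : Fin (l.length + 1)) := e.symm (l i)
    have hP : StrictMono P := e.symm.strictMono.comp l.strictMono
    let i₀ : Fin (l.length + 1) := ⟨0, by lia⟩
    let i₁ : Fin (l.length + 1) := ⟨1, by lia⟩
    let i₂ : Fin (l.length + 1) := ⟨2, by lia⟩
    refine ⟨(P i₀).1, (P i₁).1, (P i₂).1, ⟨(P i₀).2.1, (P i₁).2.1, (P i₂).2.1⟩, ?_,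
      hP (show i₀ < i₁ from Nat.zero_lt_one), hP (show i₁ < i₂ from Nat.one_lt_two)⟩
    rintro _ (rfl | rfl | rfl)
    exacts [(P i₀).2.2, (P i₁).2.2, (P i₂).2.2]
end
end

section
/- Let A be a Noetherian domain and p a maximal ideal of A. Then for every n ≥ 1, contraction induces an order-preserving bijection from Spec(R[X₁,…,Xₙ]) to Spec(T[X₁,…,Xₙ]), where T is the Rees algebra of p and R the symbolic Rees algebra of p. Consequently R is a stably strong S-domain. -/
noncomputable section

open LaurentPolynomial

/-- The (extended) Rees algebra `T := A[t⁻¹, It, I²t², …]` of an ideal `I`. -/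
def reesAlgebraExt (A : Type*) [CommRing A] (I : Ideal A) :
    Subalgebra A (LaurentPolynomial A) :=
  Algebra.adjoin A
    ({T (-1)} ∪ ⋃ n : ℕ, (fun x => C x * T (n : ℤ)) '' ((I ^ n : Ideal A) : Set A))

lemma reesAlgebraExt_le_symbolicReesAlgebra (A : Type*) [CommRing A]
    (p : Ideal A) [p.IsPrime] : reesAlgebraExt A p ≤ symbolicReesAlgebra A p := by
  apply Algebra.adjoin_mono
  apply Set.union_subset_union_right
  refine Set.iUnion_mono fun n => Set.image_mono ?_
  exact fun x hx => Ideal.le_comap_map hx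

/-- The height of a prime ideal, as the height of the corresponding point of `Spec`. -/
def primeHeight {D : Type*} [CommRing D] (P : Ideal D) (hP : P.IsPrime) : ℕ∞ :=
  Order.height (⟨P, hP⟩ : PrimeSpectrum D)

/-- Kaplansky: `D` is an S-domain if for each height-one prime `P` of `D`,
the extension `P[X]` to the polynomial ring in one variable also has height `1`. -/
def IsSDomain (D : Type*) [CommRing D] : Prop :=
  ∀ (P : Ideal D) (hP : P.IsPrime), primeHeight P hP = 1 →
    ∀ hPX : (Ideal.map (Polynomial.C : D →+* Polynomial D) P).IsPrime,
      primeHeight (Ideal.map (Polynomial.C : D →+* Polynomial D) P) hPX = 1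

/-- `D` is a strong S-ring if `D/P` is an S-domain for every prime `P`. -/
def IsStrongSRing (D : Type*) [CommRing D] : Prop :=
  ∀ (P : Ideal D), P.IsPrime → IsSDomain (D ⧸ P)

/-- `D` is a stably strong S-domain if `D[X₁,…,Xₙ]` is a strong S-ring for every `n ≥ 1`. -/
def IsStablyStrongSDomain (D : Type*) [CommRing D] : Prop :=
  ∀ n : ℕ, 0 < n → IsStrongSRing (MvPolynomial (Fin n) D)

section

open Ideal

lemma symbolicPower_eq_pow (A : Type*) [CommRing A] (p : Ideal A) [p.IsMaximal] (n : ℕ) :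
    symbolicPower A p n = p ^ n := by
  rw [symbolicPower, Ideal.map_pow, Localization.AtPrime.map_eq_maximalIdeal]
  exact IsLocalization.AtPrime.under_maximalIdeal_pow p (Localization.AtPrime p) n

lemma symbolicReesAlgebra_eq_reesAlgebraExt (A : Type*) [CommRing A] (p : Ideal A)
    [p.IsMaximal] : symbolicReesAlgebra A p = reesAlgebraExt A p := by
  simp only [symbolicReesAlgebra, reesAlgebraExt, symbolicPower_eq_pow]

lemma C_mul_T_mem_of_mem_pow {A : Type*} [CommRing A] {I : Ideal A}
    {B : Subalgebra A (LaurentPolynomial A)} (hB : ∀ x ∈ I, C x * T 1 ∈ B) {n : ℕ} {x : A}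
    (hx : x ∈ I ^ n) : C x * T (n : ℤ) ∈ B := by
  induction hx using Submodule.pow_induction_on_left' with
  | algebraMap r =>
    have h : C r * T ((0 : ℕ) : ℤ) = algebraMap A (LaurentPolynomial A) r := by
      simp [LaurentPolynomial.algebraMap_apply]
    simpa only [Algebra.algebraMap_self, RingHom.id_apply, h] using B.algebraMap_mem r
  | add x y i hx hy ihx ihy => simpa only [map_add, add_mul] using B.add_mem ihx ihy
  | mem_mul m hm i x hx ih =>
    have h : C (m * x) * T ((i.succ : ℕ) : ℤ) = C m * T 1 * (C x * T (i : ℤ)) := by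
      rw [Nat.cast_succ, T_add, map_mul]
      ring
    rw [h]
    exact B.mul_mem (hB m hm) ih

lemma reesAlgebraExt_fg (A : Type*) [CommRing A] {I : Ideal A} (hI : I.FG) :
    (reesAlgebraExt A I).FG := by
  obtain ⟨s, rfl⟩ := hI
  refine Subalgebra.fg_def.mpr ⟨{T (-1)} ∪ (fun x => C x * T 1) '' (s : Set A),
    (Set.finite_singleton _).union (s.finite_toSet.image _), le_antisymm ?_ ?_⟩
  · refine Algebra.adjoin_mono (Set.union_subset_union_right _ ?_)
    rintro _ ⟨x, hx, rfl⟩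
    exact Set.mem_iUnion.mpr ⟨1, x, by simpa using Ideal.subset_span hx, by simp⟩
  · refine Algebra.adjoin_le (Set.union_subset ?_ (Set.iUnion_subset fun n => ?_))
    · exact Set.singleton_subset_iff.mpr (Algebra.subset_adjoin (Or.inl rfl))
    · rintro _ ⟨x, hx, rfl⟩
      refine C_mul_T_mem_of_mem_pow (fun y hy => ?_) hx
      induction hy using Submodule.span_induction with
      | mem y hy => exact Algebra.subset_adjoin (Or.inr ⟨y, hy, rfl⟩)
      | zero => simp
      | add y z _ _ ihy ihz => simpa only [map_add, add_mul] using add_mem ihy ihz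
      | smul a y _ ih =>
        have h : C (a • y) * T 1 = a • (C y * T 1 : LaurentPolynomial A) := by
          rw [smul_eq_mul, map_mul, LaurentPolynomial.smul_eq_C_mul, mul_assoc]
        rw [h]
        exact Subalgebra.smul_mem _ ih a

lemma height_map_C_of_isPrime {D : Type*} [CommRing D] [IsNoetherianRing D] (P : Ideal D)
    [P.IsPrime] : (P.map (Polynomial.C : D →+* Polynomial D)).height = P.height := by
  have hprime : (P.map (Polynomial.C : D →+* Polynomial D)).IsPrime :=
    Ideal.isPrime_map_C_of_isPrime
  have hover : (P.map (Polynomial.C : D →+* Polynomial D)).LiesOver P :=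
    ⟨by
      ext x
      change x ∈ P ↔ Polynomial.C x ∈ P.map Polynomial.C
      refine ⟨fun hx => Ideal.mem_map_of_mem _ hx, fun hx => ?_⟩
      simpa using Ideal.mem_map_C_iff.mp hx 0⟩
  have : IsDomain (Polynomial D ⧸ P.map (Polynomial.C : D →+* Polynomial D)) :=
    Ideal.Quotient.isDomain _
  simp [height_eq_height_add_of_liesOver_of_hasGoingDown P]

lemma IsSDomain.of_isNoetherianRing (D : Type*) [CommRing D] [IsNoetherianRing D] :
    IsSDomain D := by
  intro P hP h hPX
  have h₁ := PrimeSpectrum.height_eq_orderHeight ⟨P, hP⟩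
  have h₂ := PrimeSpectrum.height_eq_orderHeight ⟨P.map (Polynomial.C : D →+* Polynomial D), hPX⟩
  rw [primeHeight] at h ⊢
  rw [← h₂, height_map_C_of_isPrime, h₁, h]

lemma IsStablyStrongSDomain.of_isNoetherianRing (D : Type*) [CommRing D] [IsNoetherianRing D] :
    IsStablyStrongSDomain D :=
  fun _ _ _ _ => IsSDomain.of_isNoetherianRing _

lemma isNoetherianRing_symbolicReesAlgebra (A : Type*) [CommRing A] [IsNoetherianRing A]
    (p : Ideal A) [p.IsMaximal] : IsNoetherianRing (symbolicReesAlgebra A p) := by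
  rw [symbolicReesAlgebra_eq_reesAlgebraExt]
  exact isNoetherianRing_of_fg (reesAlgebraExt_fg A (IsNoetherian.noetherian p))

lemma inclusion_reesAlgebraExt_bijective (A : Type*) [CommRing A] (p : Ideal A) [p.IsMaximal] :
    Function.Bijective
      (Subalgebra.inclusion (reesAlgebraExt_le_symbolicReesAlgebra A p)).toRingHom :=
  ⟨Subalgebra.inclusion_injective _, fun x =>
    ⟨⟨x, symbolicReesAlgebra_eq_reesAlgebraExt A p ▸ x.2⟩, rfl⟩⟩

end

/-- Let `A` be a Noetherian domain and `p` a maximal ideal of `A`. Then for every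
`n ≥ 1`, contraction induces an order-preserving bijection from `Spec(R[X₁,…,Xₙ])` to
`Spec(T[X₁,…,Xₙ])`, where `T` is the Rees algebra of `p` and `R` the symbolic Rees algebra of
`p`. Consequently `R` is a stably strong S-domain. -/
theorem statement13 (A : Type*) [CommRing A] [IsDomain A] [IsNoetherianRing A]
    (p : Ideal A) [p.IsMaximal] :
    (∀ n : ℕ, 0 < n →
      Function.Bijective
        (PrimeSpectrum.comap
          (MvPolynomial.map (σ := Fin n)
            ((Subalgebra.inclusion
              (reesAlgebraExt_le_symbolicReesAlgebra A p)).toRingHom))) ∧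
      ∀ P Q : PrimeSpectrum (MvPolynomial (Fin n) ↥(symbolicReesAlgebra A p)),
        (PrimeSpectrum.comap
            (MvPolynomial.map (σ := Fin n)
              ((Subalgebra.inclusion
                (reesAlgebraExt_le_symbolicReesAlgebra A p)).toRingHom)) P).asIdeal ≤
          (PrimeSpectrum.comap
            (MvPolynomial.map (σ := Fin n)
              ((Subalgebra.inclusion
                (reesAlgebraExt_le_symbolicReesAlgebra A p)).toRingHom)) Q).asIdeal ↔
        P.asIdeal ≤ Q.asIdeal) ∧
    IsStablyStrongSDomain ↥(symbolicReesAlgebra A p) := by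
  refine ⟨fun n _ => ?_, ?_⟩
  · have hi := inclusion_reesAlgebraExt_bijective A p
    have hmap : Function.Bijective (MvPolynomial.map (σ := Fin n)
        (Subalgebra.inclusion (reesAlgebraExt_le_symbolicReesAlgebra A p)).toRingHom) :=
      ⟨MvPolynomial.map_injective _ hi.1, MvPolynomial.map_surjective _ hi.2⟩
    let e := PrimeSpectrum.comapEquiv (RingEquiv.ofBijective _ hmap)
    exact ⟨e.symm.bijective, fun P Q => e.symm.le_iff_le (x := P) (y := Q)⟩
  · have := isNoetherianRing_symbolicReesAlgebra A p
    exact IsStablyStrongSDomain.of_isNoetherianRing _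
end
end
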